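/- arXiv:2108.08634 — 2 statements merged into one kernel-verified Lean document; each statement's English description precedes it below -/
import Mathlib

section
/- Stuffle product analogue: for all integers k_1, k_2 ≥ 1 and d_1, d_2 ≥ 0, the following identity holds in ℚ[[q]]: g(k_1; d_1)·g(k_2; d_2) = g(k_1,k_2; d_1,d_2) + g(k_2,k_1; d_2,d_1) + g(k_1+k_2; d_1+d_2) + Σ_{j=1}^{k_1+k_2−1} λ^j_{k_1,k_2} · g(j; d_1+d_2). -/
/-- The `q`-series `g(k; d)` of depth one: the coefficient of `q^N` is
`∑_{m·n = N, m,n ≥ 1} m^d n^(k-1)/(k-1)!`. -/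
noncomputable def gone (k d : ℕ) : PowerSeries ℚ :=
  PowerSeries.mk fun N =>
    ∑ m ∈ Finset.range (N + 1), ∑ n ∈ Finset.range (N + 1),
      if 1 ≤ m ∧ 1 ≤ n ∧ m * n = N then
        (m : ℚ) ^ d * (n : ℚ) ^ (k - 1) / (Nat.factorial (k - 1)) else 0

/-- The `q`-series `g(k₁,k₂; d₁,d₂)` of depth two: the coefficient of `q^N` is the sum over
`m₁ > m₂ > 0`, `n₁, n₂ > 0` with `m₁n₁ + m₂n₂ = N` of
`m₁^d₁ n₁^(k₁-1)/(k₁-1)! · m₂^d₂ n₂^(k₂-1)/(k₂-1)!`. -/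
noncomputable def gtwo (k1 k2 d1 d2 : ℕ) : PowerSeries ℚ :=
  PowerSeries.mk fun N =>
    ∑ m1 ∈ Finset.range (N + 1), ∑ m2 ∈ Finset.range (N + 1),
      ∑ n1 ∈ Finset.range (N + 1), ∑ n2 ∈ Finset.range (N + 1),
        if m2 < m1 ∧ 1 ≤ m2 ∧ 1 ≤ n1 ∧ 1 ≤ n2 ∧ m1 * n1 + m2 * n2 = N then
          ((m1 : ℚ) ^ d1 * (n1 : ℚ) ^ (k1 - 1) / (Nat.factorial (k1 - 1))) *
            ((m2 : ℚ) ^ d2 * (n2 : ℚ) ^ (k2 - 1) / (Nat.factorial (k2 - 1)))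
        else 0

/-- The rational numbers `λ^j_{k₁,k₂}`; the binomial coefficient `C(a,b)` is interpreted as `0`
when `b < 0` (i.e. when `j > k₂` resp. `j > k₁`), and `bernoulli` is the Bernoulli number
with the convention `B₁ = -1/2`. -/
noncomputable def lam (k1 k2 j : ℕ) : ℚ :=
  ((-1 : ℚ) ^ (k1 - 1) * (if j ≤ k2 then (Nat.choose (k1 + k2 - 1 - j) (k2 - j) : ℚ) else 0) +
      (-1 : ℚ) ^ (k2 - 1) * (if j ≤ k1 then (Nat.choose (k1 + k2 - 1 - j) (k1 - j) : ℚ) else 0)) *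
    bernoulli (k1 + k2 - j) / (Nat.factorial (k1 + k2 - j))


open Finset

theorem Ring.choose_neg_natCast_add_one (a s : ℕ) :
    Ring.choose (-((a : ℤ) + 1)) s = (-1) ^ s * ((a + s).choose a : ℤ) := by
  have h : (a : ℤ) + 1 + s - 1 = ((a + s : ℕ) : ℤ) := by push_cast; ring
  rw [Ring.choose_neg, h, Ring.choose_natCast, Int.negOnePow_def, zpow_natCast,
    Nat.choose_symm_add, Units.smul_def]
  simp

theorem sum_neg_one_pow_mul_choose_mul_choose (a b M : ℕ) :
    ∑ s ∈ range (b + 1), (-1 : ℤ) ^ s * ((a + s).choose a : ℤ) * (M.choose (b - s) : ℤ) =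
      Ring.choose ((M : ℤ) - (a + 1)) b := by
  rw [sub_eq_neg_add, Ring.add_choose_eq b (Commute.all _ _),
    Nat.sum_antidiagonal_eq_sum_range_succ_mk]
  refine sum_congr rfl fun s _ => ?_
  rw [Ring.choose_neg_natCast_add_one, Ring.choose_natCast]

/-- The coefficient of `B_r / r! * n ^ (a + b + 1 - r) / (a + b + 1 - r)!` in the Faulhaber expansion
of `∑ i < n, i ^ a / a! * (n - i) ^ b / b!`. -/
def convCoeff (a b r : ℕ) : ℤ :=
  ∑ s ∈ range (b + 1),
    if r ≤ a + s then (-1) ^ s * ((a + s).choose a : ℤ) * ((a + b + 1 - r).choose (b - s) : ℤ) else 0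

theorem convCoeff_zero (a b : ℕ) : convCoeff a b 0 = 1 := by
  simp only [convCoeff, Nat.zero_le, if_true, Nat.sub_zero]
  rw [sum_neg_one_pow_mul_choose_mul_choose]
  have h : ((a + b + 1 : ℕ) : ℤ) - (a + 1) = (b : ℕ) := by push_cast; ring
  rw [h, Ring.choose_natCast, Nat.choose_self, Nat.cast_one]

theorem convCoeff_succ (a b t : ℕ) (ht : t ≤ a + b) :
    convCoeff a b (t + 1) = (-1) ^ b * (t.choose b : ℤ) - (-1) ^ (t + a) * (t.choose a : ℤ) := by
  have hfull := sum_neg_one_pow_mul_choose_mul_choose a b (a + b - t)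
  have h : ((a + b - t : ℕ) : ℤ) - (a + 1) = -((t : ℤ) + 1 - b) := by
    push_cast [Nat.cast_sub ht]; ring
  have h' : (t : ℤ) + 1 - b + b - 1 = (t : ℕ) := by ring
  rw [h, Ring.choose_neg, h', Ring.choose_natCast, Int.negOnePow_def, zpow_natCast,
    Units.smul_def] at hfull
  have hsplit : convCoeff a b (t + 1) =
      (∑ s ∈ range (b + 1),
        (-1 : ℤ) ^ s * ((a + s).choose a : ℤ) * ((a + b - t).choose (b - s) : ℤ)) -
      ∑ s ∈ range (b + 1), if t = a + s then (-1) ^ (t + a) * (t.choose a : ℤ) else 0 := by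
    rw [convCoeff, ← sum_sub_distrib]
    refine sum_congr rfl fun s hs => ?_
    have hs' : s ≤ b := by simpa [Nat.lt_succ_iff] using hs
    rw [Nat.add_sub_add_right]
    rcases lt_trichotomy t (a + s) with h1 | h1 | h1
    · rw [if_pos (by omega), if_neg (by omega), sub_zero]
    · rw [if_neg (by omega), if_pos h1, h1, show a + b - (a + s) = b - s by omega,
        Nat.choose_self, show a + s + a = s + 2 * a by ring, pow_add, pow_mul]
      simp
    · rw [if_neg (by omega), if_neg (by omega), Nat.choose_eq_zero_of_lt (show a + b - t < b - s by omega)]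
      simp
  rw [hsplit, hfull]
  congr 1
  rcases le_or_gt a t with hat | hat
  · rw [sum_eq_single (t - a)]
    · rw [if_pos (by omega)]
    · intro s _ hs
      rw [if_neg (by omega)]
    · intro hs
      simp at hs
      omega
  · rw [Nat.choose_eq_zero_of_lt hat]
    simp

theorem sum_range_pow_div_factorial (n p : ℕ) :
    ∑ i ∈ range n, (i : ℚ) ^ p = (p.factorial : ℚ) * ∑ r ∈ range (p + 1),
      bernoulli r / r.factorial * ((n : ℚ) ^ (p + 1 - r) / (p + 1 - r).factorial) := by
  rw [sum_range_pow, mul_sum]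
  refine sum_congr rfl fun r hr => ?_
  have hr' : r ≤ p + 1 := by simp at hr; omega
  rw [Nat.cast_choose ℚ hr', Nat.factorial_succ]
  have := Nat.cast_add_one_ne_zero (R := ℚ) p
  have h1 : ((r.factorial : ℕ) : ℚ) ≠ 0 := by positivity
  have h2 : (((p + 1 - r).factorial : ℕ) : ℚ) ≠ 0 := by positivity
  push_cast
  field_simp

theorem sum_range_pow_mul_sub_pow (a b n : ℕ) :
    ∑ i ∈ range n, ((i : ℚ) ^ a / a.factorial) * (((n : ℚ) - i) ^ b / b.factorial) =
      ∑ r ∈ range (a + b + 1), (convCoeff a b r : ℚ) *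
        (bernoulli r / r.factorial * ((n : ℚ) ^ (a + b + 1 - r) / (a + b + 1 - r).factorial)) := by
  have hbin : ∀ i : ℕ, ((i : ℚ) ^ a / a.factorial) * (((n : ℚ) - i) ^ b / b.factorial) =
      ∑ s ∈ range (b + 1), (-1 : ℚ) ^ s * (n : ℚ) ^ (b - s) /
        (a.factorial * s.factorial * (b - s).factorial) * (i : ℚ) ^ (a + s) := by
    intro i
    rw [sub_eq_neg_add, add_pow, sum_div, mul_sum]
    refine sum_congr rfl fun s hs => ?_
    have hs' : s ≤ b := by simpa [Nat.lt_succ_iff] using hs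
    rw [Nat.cast_choose ℚ hs', neg_pow, pow_add]
    have : ((a.factorial : ℕ) : ℚ) ≠ 0 := by positivity
    have : ((b.factorial : ℕ) : ℚ) ≠ 0 := by positivity
    have : ((s.factorial : ℕ) : ℚ) ≠ 0 := by positivity
    have : (((b - s).factorial : ℕ) : ℚ) ≠ 0 := by positivity
    field_simp
  simp_rw [hbin]
  rw [sum_comm]
  simp_rw [← mul_sum, sum_range_pow_div_factorial, convCoeff, Int.cast_sum, sum_mul]
  rw [sum_comm (s := range (a + b + 1))]
  refine sum_congr rfl fun s hs => ?_
  have hs' : s ≤ b := by simpa [Nat.lt_succ_iff] using hs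
  rw [mul_sum, mul_sum]
  have hsub : range (a + s + 1) ⊆ range (a + b + 1) := range_subset_range.2 (by omega)
  symm
  rw [← sum_subset hsub]
  · refine sum_congr rfl fun r hr => ?_
    have hr' : r ≤ a + s := by simpa [Nat.lt_succ_iff] using hr
    rw [if_pos hr']
    push_cast
    rw [Nat.cast_add_choose, Nat.cast_choose ℚ (show b - s ≤ a + b + 1 - r by omega),
      show a + b + 1 - r - (b - s) = a + s + 1 - r by omega,
      show a + b + 1 - r = (b - s) + (a + s + 1 - r) by omega, pow_add]
    have : ((a.factorial : ℕ) : ℚ) ≠ 0 := by positivity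
    have : ((r.factorial : ℕ) : ℚ) ≠ 0 := by positivity
    have : ((s.factorial : ℕ) : ℚ) ≠ 0 := by positivity
    have : (((b - s).factorial : ℕ) : ℚ) ≠ 0 := by positivity
    have : (((a + s + 1 - r).factorial : ℕ) : ℚ) ≠ 0 := by positivity
    have : (((b - s + (a + s + 1 - r)).factorial : ℕ) : ℚ) ≠ 0 := by positivity
    field_simp
  · intro r _ hr
    rw [if_neg (by simp at hr; omega)]
    simp

theorem lam_eq (a b t : ℕ) (ht : t ≤ a + b) :
    lam (a + 1) (b + 1) (a + b + 1 - t) =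
      ((-1) ^ a * (t.choose a : ℚ) + (-1) ^ b * (t.choose b : ℚ)) *
        (bernoulli (t + 1) / (t + 1).factorial) := by
  have key : ∀ x y : ℕ, x + y = a + b →
      (if a + b + 1 - t ≤ y + 1 then (t.choose (y + 1 - (a + b + 1 - t)) : ℚ) else 0) =
        t.choose x := by
    intro x y hxy
    split_ifs with h
    · rw [show y + 1 - (a + b + 1 - t) = t - x by omega, Nat.choose_symm (by omega)]
    · rw [Nat.choose_eq_zero_of_lt (by omega), Nat.cast_zero]
  rw [lam, show a + 1 + (b + 1) - 1 - (a + b + 1 - t) = t by omega,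
    show a + 1 + (b + 1) - (a + b + 1 - t) = t + 1 by omega, key a b rfl, key b a (add_comm _ _)]
  simp only [Nat.add_sub_cancel]
  ring

/-- Since odd Bernoulli numbers vanish beyond `B₁`, the Faulhaber coefficients agree with `lam` up to
a single correction at `B₁`. -/
theorem convCoeff_mul_bernoulli (a b t : ℕ) (ht : t ≤ a + b) :
    (convCoeff a b (t + 1) : ℚ) * (bernoulli (t + 1) / (t + 1).factorial) =
      lam (a + 1) (b + 1) (a + b + 1 - t) + if t = 0 then (if a = 0 then 1 else 0) else 0 := by
  rw [lam_eq a b t ht, convCoeff_succ a b t ht]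
  push_cast
  split_ifs with h0 ha
  · subst h0 ha
    rw [bernoulli_one]
    simp
    ring
  · subst h0
    rw [Nat.choose_eq_zero_of_lt (Nat.pos_of_ne_zero ha)]
    simp
  · rcases Nat.even_or_odd (t + 1) with he | ho
    · have hto : Odd t := by
        rcases Nat.even_or_odd t with h | h
        · exact absurd he (by simpa [Nat.even_add_one] using h)
        · exact h
      rw [pow_add, hto.neg_one_pow]
      ring
    · rw [bernoulli_eq_zero_of_odd ho (by omega)]
      simp

theorem sum_Ico_pow_mul_sub_pow (a b n : ℕ) (hn : 1 ≤ n) :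
    ∑ i ∈ Ico 1 n, ((i : ℚ) ^ a / a.factorial) * (((n : ℚ) - i) ^ b / b.factorial) =
      (n : ℚ) ^ (a + b + 1) / (a + b + 1).factorial +
        ∑ j ∈ Icc 1 (a + b + 1),
          lam (a + 1) (b + 1) j * ((n : ℚ) ^ (j - 1) / (j - 1).factorial) := by
  have hT := sum_range_pow_mul_sub_pow a b n
  rw [range_eq_Ico, sum_eq_sum_Ico_succ_bot hn] at hT
  -- The term `r = a + b + 1` may be adjoined, as its coefficient vanishes.
  have hlast : (convCoeff a b (a + b + 1) : ℚ) = 0 := by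
    rw [convCoeff_succ a b _ le_rfl, Nat.choose_symm_add,
      show a + b + a = b + 2 * a by ring, pow_add, pow_mul]
    simp
  have hext : ∑ r ∈ range (a + b + 1), (convCoeff a b r : ℚ) *
        (bernoulli r / r.factorial * ((n : ℚ) ^ (a + b + 1 - r) / (a + b + 1 - r).factorial)) =
      ∑ r ∈ range (a + b + 1 + 1), (convCoeff a b r : ℚ) *
        (bernoulli r / r.factorial * ((n : ℚ) ^ (a + b + 1 - r) / (a + b + 1 - r).factorial)) := by
    rw [sum_range_succ _ (a + b + 1), hlast, zero_mul, add_zero]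
  have hlam : ∑ j ∈ Icc 1 (a + b + 1),
        lam (a + 1) (b + 1) j * ((n : ℚ) ^ (j - 1) / (j - 1).factorial) =
      ∑ t ∈ range (a + b + 1), lam (a + 1) (b + 1) (a + b + 1 - t) *
        ((n : ℚ) ^ (a + b - t) / (a + b - t).factorial) := by
    refine sum_nbij' (fun j => a + b + 1 - j) (fun t => a + b + 1 - t) ?_ ?_ ?_ ?_ ?_
    · intro j hj; simp at hj ⊢; omega
    · intro j hj; simp at hj ⊢; omega
    · intro j hj; simp at hj ⊢; omega
    · intro j hj; simp at hj ⊢; omega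
    · intro j hj
      simp only [mem_Icc] at hj
      rw [show a + b + 1 - (a + b + 1 - j) = j by omega,
        show a + b - (a + b + 1 - j) = j - 1 by omega]
  rw [hext, sum_range_succ', convCoeff_zero] at hT
  have hterm : ∀ t ∈ range (a + b + 1), (convCoeff a b (t + 1) : ℚ) *
        (bernoulli (t + 1) / (t + 1).factorial *
          ((n : ℚ) ^ (a + b + 1 - (t + 1)) / (a + b + 1 - (t + 1)).factorial)) =
      lam (a + 1) (b + 1) (a + b + 1 - t) * ((n : ℚ) ^ (a + b - t) / (a + b - t).factorial) +
        if t = 0 then (if a = 0 then (n : ℚ) ^ b / b.factorial else 0) else 0 := by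
    intro t ht
    have ht' : t ≤ a + b := by simpa [Nat.lt_succ_iff] using ht
    rw [← mul_assoc, convCoeff_mul_bernoulli a b t ht', Nat.add_sub_add_right, add_mul]
    congr 1
    split_ifs with h0 ha
    · subst h0 ha; simp
    · simp
    · simp
  rw [sum_congr rfl hterm, sum_add_distrib, sum_ite_eq' (range (a + b + 1)) 0, ← hlam] at hT
  have hzero : ((0 : ℕ) : ℚ) ^ a / a.factorial * (((n : ℚ) - (0 : ℕ)) ^ b / b.factorial) =
      if a = 0 then (n : ℚ) ^ b / b.factorial else 0 := by
    split_ifs with ha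
    · subst ha; simp
    · simp [ha]
  rw [hzero] at hT
  simp at hT
  linarith

theorem coeff_gone_of_le (k d : ℕ) {p N : ℕ} (hp : p ≤ N) :
    PowerSeries.coeff p (gone k d) = ∑ m ∈ range (N + 1), ∑ n ∈ range (N + 1),
      if 1 ≤ m ∧ 1 ≤ n ∧ m * n = p then
        (m : ℚ) ^ d * (n : ℚ) ^ (k - 1) / (Nat.factorial (k - 1)) else 0 := by
  have hsub : range (p + 1) ⊆ range (N + 1) := range_subset_range.2 (by omega)
  rw [gone, PowerSeries.coeff_mk, ← sum_subset hsub]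
  · refine sum_congr rfl fun m _ => sum_subset hsub fun n _ hn => if_neg ?_
    rintro ⟨h1, h2, h3⟩
    simp only [mem_range, not_lt] at hn
    nlinarith
  · intro m _ hm
    refine sum_eq_zero fun n _ => if_neg ?_
    rintro ⟨h1, h2, h3⟩
    simp only [mem_range, not_lt] at hm
    nlinarith

theorem coeff_gone_mul_gone (k1 k2 d1 d2 N : ℕ) :
    PowerSeries.coeff N (gone k1 d1 * gone k2 d2) =
      ∑ m1 ∈ range (N + 1), ∑ m2 ∈ range (N + 1), ∑ n1 ∈ range (N + 1), ∑ n2 ∈ range (N + 1),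
        if 1 ≤ m1 ∧ 1 ≤ m2 ∧ 1 ≤ n1 ∧ 1 ≤ n2 ∧ m1 * n1 + m2 * n2 = N then
          ((m1 : ℚ) ^ d1 * (n1 : ℚ) ^ (k1 - 1) / (Nat.factorial (k1 - 1))) *
            ((m2 : ℚ) ^ d2 * (n2 : ℚ) ^ (k2 - 1) / (Nat.factorial (k2 - 1)))
        else 0 := by
  rw [PowerSeries.coeff_mul]
  have hcoeff : ∀ x ∈ antidiagonal N,
      PowerSeries.coeff x.1 (gone k1 d1) * PowerSeries.coeff x.2 (gone k2 d2) =
      ∑ m1 ∈ range (N + 1), ∑ m2 ∈ range (N + 1), ∑ n1 ∈ range (N + 1), ∑ n2 ∈ range (N + 1),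
        if (m1 * n1, m2 * n2) = x then
          if 1 ≤ m1 ∧ 1 ≤ m2 ∧ 1 ≤ n1 ∧ 1 ≤ n2 then
            ((m1 : ℚ) ^ d1 * (n1 : ℚ) ^ (k1 - 1) / (Nat.factorial (k1 - 1))) *
              ((m2 : ℚ) ^ d2 * (n2 : ℚ) ^ (k2 - 1) / (Nat.factorial (k2 - 1)))
          else 0
        else 0 := by
    rintro ⟨p, r⟩ hx
    have hx' : p + r = N := HasAntidiagonal.mem_antidiagonal.1 hx
    rw [coeff_gone_of_le k1 d1 (show p ≤ N by omega), coeff_gone_of_le k2 d2 (show r ≤ N by omega),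
      sum_mul_sum]
    refine sum_congr rfl fun m1 _ => sum_congr rfl fun m2 _ => ?_
    rw [sum_mul_sum]
    refine sum_congr rfl fun n1 _ => sum_congr rfl fun n2 _ => ?_
    rw [ite_zero_mul_ite_zero, ← ite_and]
    refine if_congr ?_ rfl rfl
    rw [Prod.mk.injEq]
    tauto
  rw [sum_congr rfl hcoeff, sum_comm]
  refine sum_congr rfl fun m1 _ => ?_
  rw [sum_comm]
  refine sum_congr rfl fun m2 _ => ?_
  rw [sum_comm]
  refine sum_congr rfl fun n1 _ => ?_
  rw [sum_comm]
  refine sum_congr rfl fun n2 _ => ?_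
  rw [sum_ite_eq, ← ite_and]
  refine if_congr ?_ rfl rfl
  rw [HasAntidiagonal.mem_antidiagonal]
  tauto

theorem sum_ite_mul_add_eq {m : ℕ} (hm : 1 ≤ m) (N : ℕ) (h : ℕ → ℕ → ℚ) :
    (∑ n1 ∈ range (N + 1), ∑ n2 ∈ range (N + 1),
      if 1 ≤ n1 ∧ 1 ≤ n2 ∧ m * (n1 + n2) = N then h n1 n2 else 0) =
    ∑ n ∈ range (N + 1), if 1 ≤ n ∧ m * n = N then ∑ i ∈ Ico 1 n, h i (n - i) else 0 := by
  have hinner : ∀ n ∈ range (N + 1),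
      (if 1 ≤ n ∧ m * n = N then ∑ i ∈ Ico 1 n, h i (n - i) else 0) =
      ∑ i ∈ range (N + 1), if 1 ≤ i ∧ i < n ∧ m * n = N then h i (n - i) else 0 := by
    intro n hn
    rw [mem_range] at hn
    rw [← sum_filter]
    split_ifs with hc
    · refine sum_congr ?_ fun _ _ => rfl
      ext i
      simp only [mem_Ico, mem_filter, mem_range]
      omega
    · rw [filter_false_of_mem, sum_empty]
      rintro i - ⟨h1, h2, h3⟩
      exact hc ⟨by omega, h3⟩
  rw [sum_congr rfl hinner, sum_comm (s := range (N + 1)) (t := range (N + 1))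
    (f := fun n i => if 1 ≤ i ∧ i < n ∧ m * n = N then h i (n - i) else 0)]
  refine sum_congr rfl fun i _ => ?_
  rw [← sum_filter, ← sum_filter]
  refine sum_nbij' (fun n2 => i + n2) (fun n => n - i) ?_ ?_ ?_ ?_ ?_
  · intro n2 hn2
    simp only [mem_filter, mem_range] at hn2 ⊢
    obtain ⟨-, h1, h2, h3⟩ := hn2
    exact ⟨by nlinarith, h1, by omega, h3⟩
  · intro n hn
    simp only [mem_filter, mem_range] at hn ⊢
    obtain ⟨h0, h1, h2, h3⟩ := hn
    exact ⟨by omega, h1, by omega, by rwa [Nat.add_sub_cancel' h2.le]⟩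
  · intro n2 _
    simp
  · intro n hn
    simp only [mem_filter] at hn
    exact Nat.add_sub_cancel' hn.2.2.1.le
  · intro n2 _
    simp

theorem sum_diagonal_eq_coeff (a b d1 d2 N : ℕ) :
    (∑ m ∈ range (N + 1), ∑ n1 ∈ range (N + 1), ∑ n2 ∈ range (N + 1),
      if 1 ≤ m ∧ 1 ≤ n1 ∧ 1 ≤ n2 ∧ m * n1 + m * n2 = N then
        ((m : ℚ) ^ d1 * (n1 : ℚ) ^ a / a.factorial) * ((m : ℚ) ^ d2 * (n2 : ℚ) ^ b / b.factorial)
      else 0) =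
    PowerSeries.coeff N (gone (a + b + 2) (d1 + d2) +
      ∑ j ∈ Icc 1 (a + b + 1), lam (a + 1) (b + 1) j • gone j (d1 + d2)) := by
  simp only [map_add, map_sum, map_smul, gone, PowerSeries.coeff_mk, smul_eq_mul, mul_sum]
  rw [sum_comm (s := Icc 1 (a + b + 1)), ← sum_add_distrib]
  refine sum_congr rfl fun m _ => ?_
  rw [sum_comm (s := Icc 1 (a + b + 1)), ← sum_add_distrib]
  rcases Nat.eq_zero_or_pos m with rfl | hm
  · simp
  have hm' : 1 ≤ m := hm
  simp only [hm', true_and, ← mul_add]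
  rw [sum_ite_mul_add_eq hm' N fun n1 n2 =>
    ((m : ℚ) ^ d1 * (n1 : ℚ) ^ a / a.factorial) * ((m : ℚ) ^ d2 * (n2 : ℚ) ^ b / b.factorial)]
  refine sum_congr rfl fun n _ => ?_
  split_ifs with hc
  · have hconv := congrArg (fun x => (m : ℚ) ^ (d1 + d2) * x) (sum_Ico_pow_mul_sub_pow a b n hc.1)
    simp only [mul_add, mul_sum] at hconv
    rw [show a + b + 2 - 1 = a + b + 1 by omega, mul_div_assoc]
    refine Eq.trans (sum_congr rfl fun i hi => ?_) (hconv.trans ?_)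
    · rw [Nat.cast_sub (mem_Ico.1 hi).2.le, pow_add]
      ring
    · congr 1
      exact sum_congr rfl fun j _ => by ring
  · simp

/-- the stuffle product analogue for the bi-indexed `q`-series `g`. -/
theorem stmt_5 (k1 k2 d1 d2 : ℕ) (h1 : 1 ≤ k1) (h2 : 1 ≤ k2) :
    gone k1 d1 * gone k2 d2 =
      gtwo k1 k2 d1 d2 + gtwo k2 k1 d2 d1 + gone (k1 + k2) (d1 + d2) +
        ∑ j ∈ Finset.Icc 1 (k1 + k2 - 1), lam k1 k2 j • gone j (d1 + d2) := by
  obtain ⟨a, rfl⟩ : ∃ a, k1 = a + 1 := ⟨k1 - 1, by omega⟩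
  obtain ⟨b, rfl⟩ : ∃ b, k2 = b + 1 := ⟨k2 - 1, by omega⟩
  ext N
  rw [add_assoc, map_add, show a + 1 + (b + 1) = a + b + 2 by ring,
    show a + b + 2 - 1 = a + b + 1 by omega, ← sum_diagonal_eq_coeff, coeff_gone_mul_gone,
    map_add, gtwo, gtwo, PowerSeries.coeff_mk, PowerSeries.coeff_mk]
  simp only [Nat.add_sub_cancel]
  -- Exchange the two index pairs in the second depth-two sum.
  rw [sum_comm (s := range (N + 1)) (t := range (N + 1))
    (f := fun m1 m2 => ∑ n1 ∈ range (N + 1), ∑ n2 ∈ range (N + 1),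
      if m2 < m1 ∧ 1 ≤ m2 ∧ 1 ≤ n1 ∧ 1 ≤ n2 ∧ m1 * n1 + m2 * n2 = N then
        ((m1 : ℚ) ^ d2 * (n1 : ℚ) ^ b / b.factorial) *
          ((m2 : ℚ) ^ d1 * (n2 : ℚ) ^ a / a.factorial)
      else 0), ← sum_add_distrib, ← sum_add_distrib]
  refine sum_congr rfl fun m1 hm1 => ?_
  have hdiag : (∑ n1 ∈ range (N + 1), ∑ n2 ∈ range (N + 1),
      if 1 ≤ m1 ∧ 1 ≤ n1 ∧ 1 ≤ n2 ∧ m1 * n1 + m1 * n2 = N then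
        ((m1 : ℚ) ^ d1 * (n1 : ℚ) ^ a / a.factorial) *
          ((m1 : ℚ) ^ d2 * (n2 : ℚ) ^ b / b.factorial)
      else 0) =
      ∑ m2 ∈ range (N + 1), if m1 = m2 then ∑ n1 ∈ range (N + 1), ∑ n2 ∈ range (N + 1),
        if 1 ≤ m1 ∧ 1 ≤ n1 ∧ 1 ≤ n2 ∧ m1 * n1 + m2 * n2 = N then
          ((m1 : ℚ) ^ d1 * (n1 : ℚ) ^ a / a.factorial) *
            ((m2 : ℚ) ^ d2 * (n2 : ℚ) ^ b / b.factorial)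
        else 0 else 0 := by
    rw [sum_ite_eq, if_pos hm1]
  rw [hdiag, ← sum_add_distrib, ← sum_add_distrib]
  refine sum_congr rfl fun m2 _ => ?_
  rw [sum_comm (s := range (N + 1)) (t := range (N + 1))
    (f := fun n1 n2 =>
      if m1 < m2 ∧ 1 ≤ m1 ∧ 1 ≤ n1 ∧ 1 ≤ n2 ∧ m2 * n1 + m1 * n2 = N then
        ((m2 : ℚ) ^ d2 * (n1 : ℚ) ^ b / b.factorial) *
          ((m1 : ℚ) ^ d1 * (n2 : ℚ) ^ a / a.factorial)
      else 0)]
  rcases lt_trichotomy m1 m2 with h | rfl | h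
  · simp only [h, h.not_gt, h.ne, false_and, if_false, sum_const_zero, true_and, add_zero, zero_add]
    refine sum_congr rfl fun n1 _ => sum_congr rfl fun n2 _ => ?_
    rw [mul_comm ((m1 : ℚ) ^ d1 * _ / _), add_comm (m1 * n1)]
    refine if_congr ?_ rfl rfl
    omega
  · simp only [lt_irrefl, false_and, if_false, sum_const_zero, if_true, zero_add]
    refine sum_congr rfl fun n1 _ => sum_congr rfl fun n2 _ => if_congr ?_ rfl rfl
    tauto
  · simp only [h, h.not_gt, h.ne', false_and, if_false, sum_const_zero, true_and, add_zero]
    refine sum_congr rfl fun n1 _ => sum_congr rfl fun n2 _ => if_congr ?_ rfl rfl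
    omega
end

section
/- Double shuffle equations for combinatorial double Eisenstein series: let q be real with 0 < q < 1 and let x₁, x₂, y₁, y₂ be real numbers such that x₁, x₂, y₁, y₂, x₁−x₂, x₁+x₂, y₁−y₂ and y₁+y₂ are all nonzero and |x₁|+|x₂|+|y₁|+|y₂| < log(1/q) (which guarantees absolute convergence of all series involved). Then, with P_E(x₁,x₂;y₁,y₂) := E₁(x₁;y₁)·E₁(x₂;y₂), the following two equalities hold: P_E(x₁,x₂;y₁,y₂) = E₂(x₁,x₂;y₁,y₂) + E₂(x₂,x₁;y₂,y₁) + (E₁(x₁;y₁+y₂) − E₁(x₂;y₁+y₂))/(x₁−x₂), and P_E(x₁,x₂;y₁,y₂) = E₂(x₁+x₂,x₂;y₁,y₂−y₁) + E₂(x₁+x₂,x₁;y₂,y₁−y₂) + (E₁(x₁+x₂;y₁) − E₁(x₁+x₂;y₂))/(y₁−y₂). -/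
/-- The hyperbolic cotangent `coth t = cosh t / sinh t`. -/
noncomputable def coth (t : ℝ) : ℝ := Real.cosh t / Real.sinh t

/-- `b₁(x;y) = -(1/4)(coth(x/2) + coth(y/2)) + (1/2)(1/x + 1/y)`. -/
noncomputable def b1 (x y : ℝ) : ℝ :=
  -(1 / 4) * (coth (x / 2) + coth (y / 2)) + (1 / 2) * (1 / x + 1 / y)

/-- `R*_b(x₁,x₂;y₁,y₂) = (b₁(x₁;y₁+y₂) - b₁(x₂;y₁+y₂))/(x₁-x₂)`. -/
noncomputable def Rast (x1 x2 y1 y2 : ℝ) : ℝ :=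
  (b1 x1 (y1 + y2) - b1 x2 (y1 + y2)) / (x1 - x2)

/-- `Rsh_b(x₁,x₂;y₁,y₂) = (b₁(x₁+x₂;y₁) - b₁(x₁+x₂;y₂))/(y₁-y₂)`. -/
noncomputable def Rsh (x1 x2 y1 y2 : ℝ) : ℝ :=
  (b1 (x1 + x2) y1 - b1 (x1 + x2) y2) / (y1 - y2)

/-- `P_b(x₁,x₂;y₁,y₂) = b₁(x₁;y₁)·b₁(x₂;y₂)`. -/
noncomputable def Pb (x1 x2 y1 y2 : ℝ) : ℝ := b1 x1 y1 * b1 x2 y2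

/-- The depth-two Bernoulli generating function `b₂`. -/
noncomputable def b2 (x1 x2 y1 y2 : ℝ) : ℝ :=
  (1 / 3) * Pb x1 x2 y1 y2 + (1 / 3) * Pb (x1 - x2) x2 y1 (y1 + y2)
    - (5 / 12) * Rsh (x1 - x2) x2 y1 (y1 + y2) - (1 / 12) * Rsh (-x2) x1 (-y2) y1
    + (1 / 4) * Rsh (x2 - x1) x1 y2 (y1 + y2)
    - (5 / 12) * Rast x1 x2 y1 y2 - (1 / 12) * Rast (x2 - x1) x2 (-y1) (y1 + y2)
    + (1 / 4) * Rast (x1 - x2) x1 (-y2) (y1 + y2)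


/-- The depth-one generating series `g₁(x;y) = ∑_{m,n ≥ 1} e^{nx+my} q^{mn}` (here
`p = (m-1, n-1)` runs over `ℕ × ℕ`). -/
noncomputable def g1f (q x y : ℝ) : ℝ :=
  ∑' p : ℕ × ℕ,
    Real.exp ((p.2 + 1 : ℕ) * x + (p.1 + 1 : ℕ) * y) * q ^ ((p.1 + 1) * (p.2 + 1))

/-- The depth-two generating series
`g₂(x₁,x₂;y₁,y₂) = ∑_{m₁ > m₂ ≥ 1, n₁,n₂ ≥ 1} e^{n₁x₁+n₂x₂+m₁y₁+m₂y₂} q^{m₁n₁+m₂n₂}`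
(here `p = ((m₁,n₁),(m₂,n₂))`). -/
noncomputable def g2f (q x1 x2 y1 y2 : ℝ) : ℝ :=
  ∑' p : (ℕ × ℕ) × ℕ × ℕ,
    if p.2.1 < p.1.1 ∧ 1 ≤ p.2.1 ∧ 1 ≤ p.1.2 ∧ 1 ≤ p.2.2 then
      Real.exp (p.1.2 * x1 + p.2.2 * x2 + p.1.1 * y1 + p.2.1 * y2) *
        q ^ (p.1.1 * p.1.2 + p.2.1 * p.2.2)
    else 0

/-- The combinatorial Eisenstein series `E₁ = b₁ + g₁`. -/
noncomputable def E1 (q x y : ℝ) : ℝ := b1 x y + g1f q x y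

/-- The combinatorial double Eisenstein series `E₂`. -/
noncomputable def E2 (q x1 x2 y1 y2 : ℝ) : ℝ :=
  b2 x1 x2 y1 y2 - b1 (x1 - x2) y2 * g1f q x1 (y1 + y2) - (1 / 2) * g1f q x1 (y1 + y2)
    + b1 x2 y2 * g1f q x1 y1 + b1 (x1 - x2) y1 * g1f q x2 (y1 + y2) + g2f q x1 x2 y1 y2

/-- The odd function `-(1/4) coth(x/2) + 1/(2x)`, in terms of which `b₁(x;y) = c(x) + c(y)`. -/
noncomputable def cothPart (x : ℝ) : ℝ := -(1 / 4) * coth (x / 2) + (1 / 2) * x⁻¹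

lemma coth_neg (t : ℝ) : coth (-t) = -coth t := by
  simp [coth, div_neg]

lemma cothPart_neg (x : ℝ) : cothPart (-x) = -cothPart x := by
  simp only [cothPart, neg_div, coth_neg, inv_neg]
  ring

lemma b1_eq_cothPart (x y : ℝ) : b1 x y = cothPart x + cothPart y := by
  simp only [b1, cothPart]
  ring

lemma coth_add_mul {a b : ℝ} (ha : a ≠ 0) (hb : b ≠ 0) (hab : a + b ≠ 0) :
    coth (a + b) * (coth a + coth b) = 1 + coth a * coth b := by
  have h1 : Real.sinh a ≠ 0 := by simpa using ha
  have h2 : Real.sinh b ≠ 0 := by simpa using hb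
  have h3 : Real.sinh (a + b) ≠ 0 := by simpa using hab
  simp only [coth]
  field_simp
  rw [Real.sinh_add, Real.cosh_add]
  ring

/-- The addition theorem for `coth`, written in terms of `cothPart`. -/
lemma cothPart_add {a b : ℝ} (ha : a ≠ 0) (hb : b ≠ 0) (hab : a + b ≠ 0) :
    cothPart (a + b) * (cothPart a + cothPart b) - cothPart a * cothPart b
      - (a + b)⁻¹ * (cothPart a + cothPart b) / 2 - cothPart (a + b) * (a⁻¹ + b⁻¹) / 2
      + (cothPart a * b⁻¹ + cothPart b * a⁻¹) / 2 = 1 / 16 := by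
  have h := coth_add_mul (a := a / 2) (b := b / 2) (by simpa using ha) (by simpa using hb)
    (by rw [← add_div]; simpa using hab)
  rw [← add_div] at h
  have hu : (a + b)⁻¹ * (a⁻¹ + b⁻¹) = a⁻¹ * b⁻¹ := by
    field_simp
    ring
  simp only [cothPart]
  linear_combination (1 / 16) * h - (1 / 4) * hu

lemma b2_eq_cothPart (x1 x2 y1 y2 : ℝ) :
    b2 x1 x2 y1 y2 =
      (1 / 3) * ((cothPart x1 + cothPart y1) * (cothPart x2 + cothPart y2))
      + (1 / 3) * ((cothPart (x1 - x2) + cothPart y1) * (cothPart x2 + cothPart (y1 + y2)))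
      + (5 / 12) * ((cothPart y1 - cothPart (y1 + y2)) * y2⁻¹)
      - (1 / 12) * ((cothPart y1 + cothPart y2) * (y1 + y2)⁻¹)
      - (1 / 4) * ((cothPart y2 - cothPart (y1 + y2)) * y1⁻¹)
      - (5 / 12) * ((cothPart x1 - cothPart x2) * (x1 - x2)⁻¹)
      - (1 / 12) * ((cothPart (x1 - x2) + cothPart x2) * x1⁻¹)
      - (1 / 4) * ((cothPart (x1 - x2) - cothPart x1) * x2⁻¹) := by
  have e1 : y1 - (y1 + y2) = -y2 := by ring
  have e2 : y2 - (y1 + y2) = -y1 := by ring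
  have e3 : -y2 - y1 = -(y1 + y2) := by ring
  have e4 : x2 - x1 - x2 = -x1 := by ring
  have e5 : x1 - x2 - x1 = -x2 := by ring
  simp only [b2, Pb, Rsh, Rast, b1_eq_cothPart, e1, e2, e3, e4, e5, div_eq_mul_inv, inv_neg,
    cothPart_neg]
  rw [← neg_sub x1 x2, cothPart_neg]
  ring

lemma Pb_eq_stuffle {x1 x2 y1 y2 : ℝ} (hx1 : x1 ≠ 0) (hx2 : x2 ≠ 0) (hy1 : y1 ≠ 0)
    (hy2 : y2 ≠ 0) (hxm : x1 - x2 ≠ 0) (hyp : y1 + y2 ≠ 0) :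
    b1 x1 y1 * b1 x2 y2 =
      b2 x1 x2 y1 y2 + b2 x2 x1 y2 y1 + (b1 x1 (y1 + y2) - b1 x2 (y1 + y2)) / (x1 - x2) := by
  have hx := cothPart_add hxm hx2 (by simpa using hx1)
  have hy := cothPart_add hy1 hy2 hyp
  rw [sub_add_cancel] at hx
  simp only [b2_eq_cothPart, b1_eq_cothPart]
  rw [← neg_sub x1 x2, add_comm y2 y1, cothPart_neg, inv_neg, div_eq_mul_inv]
  linear_combination (1 / 3) * hx - (1 / 3) * hy

lemma Pb_eq_shuffle {x1 x2 y1 y2 : ℝ} (hx1 : x1 ≠ 0) (hx2 : x2 ≠ 0) (hy1 : y1 ≠ 0)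
    (hy2 : y2 ≠ 0) (hxp : x1 + x2 ≠ 0) (hym : y1 - y2 ≠ 0) :
    b1 x1 y1 * b1 x2 y2 =
      b2 (x1 + x2) x2 y1 (y2 - y1) + b2 (x1 + x2) x1 y2 (y1 - y2)
        + (b1 (x1 + x2) y1 - b1 (x1 + x2) y2) / (y1 - y2) := by
  have hx := cothPart_add hx1 hx2 hxp
  have hy := cothPart_add hym hy2 (by simpa using hy1)
  rw [sub_add_cancel] at hy
  simp only [b2_eq_cothPart, b1_eq_cothPart, add_sub_cancel_right, add_sub_cancel_left,
    add_sub_cancel]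
  rw [← neg_sub y1 y2, cothPart_neg, inv_neg, div_eq_mul_inv]
  linear_combination (1 / 3) * hy - (1 / 3) * hx

/-- The summand of `g1f`. -/
noncomputable def g1Term (q x y : ℝ) (p : ℕ × ℕ) : ℝ :=
  Real.exp ((p.2 + 1 : ℕ) * x + (p.1 + 1 : ℕ) * y) * q ^ ((p.1 + 1) * (p.2 + 1))

lemma g1Term_eq (q x y : ℝ) (m n : ℕ) :
    g1Term q x y (m, n) = Real.exp y ^ (m + 1) * (Real.exp x * q ^ (m + 1)) ^ (n + 1) := by
  simp only [g1Term, Real.exp_add, Real.exp_nat_mul, mul_pow, pow_mul]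
  ring

lemma g1Term_swap (q x y : ℝ) (p : ℕ × ℕ) : g1Term q x y p.swap = g1Term q y x p := by
  simp only [g1Term, Prod.fst_swap, Prod.snd_swap, mul_comm (p.2 + 1) (p.1 + 1), add_comm]

lemma g1f_swap (q x y : ℝ) : g1f q x y = g1f q y x :=
  ((Equiv.prodComm ℕ ℕ).tsum_eq (g1Term q x y)).symm.trans
    (tsum_congr fun p => g1Term_swap q x y p)

lemma summable_g1Term {q x y : ℝ} (hq0 : 0 < q) (hq1 : q < 1) (hx : Real.exp x * q < 1)
    (hy : Real.exp y * q < 1) : Summable (g1Term q x y) := by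
  have hs : Summable fun p : ℕ × ℕ => (Real.exp y * q) ^ p.1 * (Real.exp x * q) ^ p.2 :=
    (summable_geometric_of_lt_one (by positivity) hy).mul_of_nonneg
      (summable_geometric_of_lt_one (by positivity) hx)
      (fun _ => by positivity) (fun _ => by positivity)
  refine Summable.of_nonneg_of_le (fun p => by unfold g1Term; positivity) ?_
    (hs.mul_left (Real.exp x * Real.exp y * q))
  rintro ⟨m, n⟩
  have hpow : q ^ ((m + 1) * (n + 1)) ≤ q ^ (m + n + 1) :=
    pow_le_pow_of_le_one hq0.le hq1.le (by nlinarith [Nat.zero_le (m * n)])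
  calc g1Term q x y (m, n)
      = Real.exp x ^ (n + 1) * Real.exp y ^ (m + 1) * q ^ ((m + 1) * (n + 1)) := by
        simp only [g1Term, Real.exp_add, Real.exp_nat_mul]
    _ ≤ Real.exp x ^ (n + 1) * Real.exp y ^ (m + 1) * q ^ (m + n + 1) := by gcongr
    _ = _ := by ring

/-- Summing over `(ℕ × ℕ) × (ℕ × ℕ)` by comparing the two first coordinates. -/
lemma tsum_trichotomy {G : (ℕ × ℕ) × ℕ × ℕ → ℝ} (hG : Summable G) :
    ∑' z, G z =
      (∑' z : (ℕ × ℕ) × ℕ × ℕ, G ((z.1.1 + z.2.1 + 1, z.1.2), z.2))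
      + (∑' z : (ℕ × ℕ) × ℕ × ℕ, G (z.2, (z.1.1 + z.2.1 + 1, z.1.2)))
      + ∑' z : ℕ × ℕ × ℕ, G ((z.1, z.2.1), (z.1, z.2.2)) := by
  have key : ∀ {α : Type} (φ : α → (ℕ × ℕ) × ℕ × ℕ) (S : Set ((ℕ × ℕ) × ℕ × ℕ)),
      Function.Injective φ → Set.range φ = S → ∑' z, S.indicator G z = ∑' a, G (φ a) := by
    rintro α φ S hφ rfl
    rw [← hφ.tsum_eq Set.support_indicator_subset]
    exact tsum_congr fun a => Set.indicator_of_mem (Set.mem_range_self a) G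
  have h1 := key (fun z : (ℕ × ℕ) × ℕ × ℕ => ((z.1.1 + z.2.1 + 1, z.1.2), z.2))
    {z | z.2.1 < z.1.1}
    (by rintro ⟨⟨a, b⟩, c, d⟩ ⟨⟨a', b'⟩, c', d'⟩ h; simp at h ⊢; omega)
    (by
      ext ⟨⟨a, b⟩, c, d⟩
      simp only [Set.mem_range, Set.mem_ofPred_eq]
      constructor
      · rintro ⟨⟨⟨a', b'⟩, c', d'⟩, h⟩
        simp at h
        omega
      · intro h
        exact ⟨((a - c - 1, b), c, d), by simp; omega⟩)
  have h2 := key (fun z : (ℕ × ℕ) × ℕ × ℕ => (z.2, (z.1.1 + z.2.1 + 1, z.1.2)))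
    {z | z.1.1 < z.2.1}
    (by rintro ⟨⟨a, b⟩, c, d⟩ ⟨⟨a', b'⟩, c', d'⟩ h; simp at h ⊢; omega)
    (by
      ext ⟨⟨a, b⟩, c, d⟩
      simp only [Set.mem_range, Set.mem_ofPred_eq]
      constructor
      · rintro ⟨⟨⟨a', b'⟩, c', d'⟩, h⟩
        simp at h
        omega
      · intro h
        exact ⟨((c - a - 1, d), a, b), by simp; omega⟩)
  have h3 := key (fun z : ℕ × ℕ × ℕ => ((z.1, z.2.1), (z.1, z.2.2)))
    {z | z.1.1 = z.2.1}
    (by rintro ⟨a, b, c⟩ ⟨a', b', c'⟩ h; simp at h ⊢; omega)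
    (by
      ext ⟨⟨a, b⟩, c, d⟩
      simp only [Set.mem_range, Set.mem_ofPred_eq]
      constructor
      · rintro ⟨⟨a', b', c'⟩, h⟩
        simp at h
        omega
      · intro h
        exact ⟨(a, b, d), by simpa using h⟩)
  rw [← h1, ← h2, ← h3, ← (hG.indicator _).tsum_add (hG.indicator _),
    ← ((hG.indicator _).add (hG.indicator _)).tsum_add (hG.indicator _)]
  refine tsum_congr fun z => ?_
  rcases lt_trichotomy z.1.1 z.2.1 with h | h | h
  · simp [Set.indicator, h, h.not_gt, h.ne]
  · simp [Set.indicator, h]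
  · simp [Set.indicator, h, h.not_gt, h.ne']

lemma g2f_eq_tsum (q x1 x2 y1 y2 : ℝ) :
    g2f q x1 x2 y1 y2 = ∑' z : (ℕ × ℕ) × ℕ × ℕ,
      Real.exp ((z.1.2 + 1) * x1 + (z.2.2 + 1) * x2 + (z.1.1 + z.2.1 + 2) * y1
        + (z.2.1 + 1) * y2)
        * q ^ ((z.1.1 + z.2.1 + 2) * (z.1.2 + 1) + (z.2.1 + 1) * (z.2.2 + 1)) := by
  have hinj : Function.Injective fun z : (ℕ × ℕ) × ℕ × ℕ =>
      ((z.1.1 + z.2.1 + 2, z.1.2 + 1), (z.2.1 + 1, z.2.2 + 1)) := by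
    rintro ⟨⟨a, b⟩, c, d⟩ ⟨⟨a', b'⟩, c', d'⟩ h
    simp at h ⊢
    omega
  rw [g2f, ← hinj.tsum_eq]
  · refine tsum_congr fun z => ?_
    rw [if_pos ⟨by dsimp only; omega, by simp, by simp, by simp⟩]
    push_cast
    rfl
  · rintro ⟨⟨a, b⟩, c, d⟩ h
    have h' : c < a ∧ 1 ≤ c ∧ 1 ≤ b ∧ 1 ≤ d := by
      by_contra hn
      exact h (if_neg hn)
    exact ⟨((a - c - 1, b - 1), c - 1, d - 1), by simp; omega⟩

lemma g2f_eq_tsum_stuffle (q x1 x2 y1 y2 : ℝ) :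
    g2f q x1 x2 y1 y2 = ∑' z : (ℕ × ℕ) × ℕ × ℕ,
      g1Term q x1 y1 (z.1.1 + z.2.1 + 1, z.1.2) * g1Term q x2 y2 z.2 := by
  rw [g2f_eq_tsum]
  refine tsum_congr fun z => ?_
  simp only [g1Term]
  rw [mul_mul_mul_comm, ← Real.exp_add, ← pow_add]
  push_cast
  ring_nf

lemma g2f_eq_tsum_shuffle (q x1 x2 y1 y2 : ℝ) :
    g2f q (x1 + x2) x2 y1 (y2 - y1) = ∑' z : (ℕ × ℕ) × ℕ × ℕ,
      g1Term q y1 x1 z.2 * g1Term q y2 x2 (z.1.1 + z.2.1 + 1, z.1.2) := by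
  have e : Function.Bijective fun z : (ℕ × ℕ) × ℕ × ℕ => ((z.2.2, z.2.1), (z.1.2, z.1.1)) :=
    Function.bijective_iff_has_inverse.2
      ⟨fun z => ((z.2.2, z.2.1), (z.1.2, z.1.1)), fun _ => rfl, fun _ => rfl⟩
  rw [g2f_eq_tsum, ← (Equiv.ofBijective _ e).tsum_eq]
  refine tsum_congr fun z => ?_
  simp only [g1Term, Equiv.ofBijective_apply]
  rw [mul_mul_mul_comm, ← Real.exp_add, ← pow_add]
  push_cast
  ring_nf

lemma exp_mul_pow_lt_one {q x : ℝ} (hq0 : 0 < q) (hq1 : q < 1) (hx : Real.exp x * q < 1)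
    (m : ℕ) : Real.exp x * q ^ (m + 1) < 1 :=
  lt_of_le_of_lt (mul_le_mul_of_nonneg_left (pow_le_of_le_one hq0.le hq1.le m.succ_ne_zero)
    (Real.exp_pos x).le) hx

lemma coth_half_sub {a b : ℝ} (hab : a - b ≠ 0) :
    coth ((a - b) / 2) = (Real.exp a + Real.exp b) / (Real.exp a - Real.exp b) := by
  have h : Real.sinh ((a - b) / 2) ≠ 0 := by simpa using hab
  have d : Real.exp a - Real.exp b ≠ 0 :=
    sub_ne_zero.2 fun h => hab (sub_eq_zero.2 (Real.exp_injective h))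
  have ea : Real.exp a = Real.exp ((a + b) / 2) * Real.exp ((a - b) / 2) := by
    rw [← Real.exp_add]
    ring_nf
  have eb : Real.exp b = Real.exp ((a + b) / 2) * Real.exp (-((a - b) / 2)) := by
    rw [← Real.exp_add]
    ring_nf
  rw [coth, div_eq_div_iff h d, Real.cosh_eq, Real.sinh_eq, ea, eb]
  ring

lemma hasSum_g1Term_snd {q x : ℝ} (hq0 : 0 < q) (hq1 : q < 1) (hx : Real.exp x * q < 1)
    (y : ℝ) (m : ℕ) :
    HasSum (fun n => g1Term q x y (m, n))
      (Real.exp y ^ (m + 1)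
        * (Real.exp x * q ^ (m + 1) * (1 - Real.exp x * q ^ (m + 1))⁻¹)) := by
  have hr := exp_mul_pow_lt_one hq0 hq1 hx m
  have h := ((hasSum_geometric_of_lt_one (by positivity) hr).mul_left
    (Real.exp x * q ^ (m + 1))).mul_left (Real.exp y ^ (m + 1))
  exact h.congr_fun fun n => by rw [g1Term_eq, pow_succ' _ n]

/-- The diagonal part of the product of two depth-one series. -/
lemma tsum_diagonal {q x1 x2 y1 y2 : ℝ} (hq0 : 0 < q) (hq1 : q < 1) (hxm : x1 - x2 ≠ 0)
    (hx1 : Real.exp x1 * q < 1) (hx2 : Real.exp x2 * q < 1) (hy : Real.exp (y1 + y2) * q < 1)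
    (hs : Summable fun z : ℕ × ℕ × ℕ =>
      g1Term q x1 y1 (z.1, z.2.1) * g1Term q x2 y2 (z.1, z.2.2)) :
    ∑' z : ℕ × ℕ × ℕ, g1Term q x1 y1 (z.1, z.2.1) * g1Term q x2 y2 (z.1, z.2.2) =
      (coth ((x1 - x2) / 2) / 2 - 1 / 2) * g1f q x1 (y1 + y2)
        - (coth ((x1 - x2) / 2) / 2 + 1 / 2) * g1f q x2 (y1 + y2) := by
  have s1 := summable_g1Term hq0 hq1 hx1 hy
  have s2 := summable_g1Term hq0 hq1 hx2 hy
  have e1 : g1f q x1 (y1 + y2) = ∑' m, ∑' n, g1Term q x1 (y1 + y2) (m, n) := s1.tsum_prod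
  have e2 : g1f q x2 (y1 + y2) = ∑' m, ∑' n, g1Term q x2 (y1 + y2) (m, n) := s2.tsum_prod
  rw [hs.tsum_prod, e1, e2, ← tsum_mul_left, ← tsum_mul_left,
    ← (s1.prod.mul_left _).tsum_sub (s2.prod.mul_left _)]
  refine tsum_congr fun m => ?_
  have h1 := hasSum_g1Term_snd hq0 hq1 hx1 y1 m
  have h2 := hasSum_g1Term_snd hq0 hq1 hx2 y2 m
  rw [(hasSum_g1Term_snd hq0 hq1 hx1 (y1 + y2) m).tsum_eq,
    (hasSum_g1Term_snd hq0 hq1 hx2 (y1 + y2) m).tsum_eq,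
    ← h1.summable.tsum_mul_tsum h2.summable (hs.prod_factor m), h1.tsum_eq, h2.tsum_eq]
  have d1 : 1 - Real.exp x1 * q ^ (m + 1) ≠ 0 :=
    (sub_pos.2 (exp_mul_pow_lt_one hq0 hq1 hx1 m)).ne'
  have d2 : 1 - Real.exp x2 * q ^ (m + 1) ≠ 0 :=
    (sub_pos.2 (exp_mul_pow_lt_one hq0 hq1 hx2 m)).ne'
  have d3 : Real.exp x1 - Real.exp x2 ≠ 0 :=
    sub_ne_zero.2 fun h => hxm (sub_eq_zero.2 (Real.exp_injective h))
  rw [coth_half_sub hxm, Real.exp_add, mul_pow]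
  generalize q ^ (m + 1) = Q at d1 d2 ⊢
  rw [mul_comm (Real.exp x2) Q] at d2 ⊢
  field_simp
  ring

lemma g1f_mul_g1f {q x1 x2 y1 y2 : ℝ} (hq0 : 0 < q) (hq1 : q < 1)
    (hx1 : Real.exp x1 * q < 1) (hx2 : Real.exp x2 * q < 1)
    (hy1 : Real.exp y1 * q < 1) (hy2 : Real.exp y2 * q < 1)
    (hxm : x1 - x2 ≠ 0) (hy : Real.exp (y1 + y2) * q < 1) :
    g1f q x1 y1 * g1f q x2 y2 =
      (∑' z : (ℕ × ℕ) × ℕ × ℕ, g1Term q x1 y1 (z.1.1 + z.2.1 + 1, z.1.2) * g1Term q x2 y2 z.2)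
      + (∑' z : (ℕ × ℕ) × ℕ × ℕ,
          g1Term q x1 y1 z.2 * g1Term q x2 y2 (z.1.1 + z.2.1 + 1, z.1.2))
      + ((coth ((x1 - x2) / 2) / 2 - 1 / 2) * g1f q x1 (y1 + y2)
        - (coth ((x1 - x2) / 2) / 2 + 1 / 2) * g1f q x2 (y1 + y2)) := by
  have s1 := summable_g1Term hq0 hq1 hx1 hy1
  have s2 := summable_g1Term hq0 hq1 hx2 hy2
  have hG : Summable fun z : (ℕ × ℕ) × ℕ × ℕ => g1Term q x1 y1 z.1 * g1Term q x2 y2 z.2 :=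
    s1.mul_of_nonneg s2 (fun p => by unfold g1Term; positivity)
      (fun p => by unfold g1Term; positivity)
  have hD := hG.comp_injective (i := fun z : ℕ × ℕ × ℕ => ((z.1, z.2.1), (z.1, z.2.2)))
    (by rintro ⟨a, b, c⟩ ⟨a', b', c'⟩ h; simp at h ⊢; omega)
  rw [← tsum_diagonal hq0 hq1 hxm hx1 hx2 hy hD, ← tsum_trichotomy hG]
  exact s1.tsum_mul_tsum s2 hG

/-- The stuffle product of depth-one generating series. -/
lemma g1f_stuffle {q x1 x2 y1 y2 : ℝ} (hq0 : 0 < q) (hq1 : q < 1)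
    (hx1 : Real.exp x1 * q < 1) (hx2 : Real.exp x2 * q < 1)
    (hy1 : Real.exp y1 * q < 1) (hy2 : Real.exp y2 * q < 1)
    (hxm : x1 - x2 ≠ 0) (hy : Real.exp (y1 + y2) * q < 1) :
    g1f q x1 y1 * g1f q x2 y2 =
      g2f q x1 x2 y1 y2 + g2f q x2 x1 y2 y1
      + ((coth ((x1 - x2) / 2) / 2 - 1 / 2) * g1f q x1 (y1 + y2)
        - (coth ((x1 - x2) / 2) / 2 + 1 / 2) * g1f q x2 (y1 + y2)) := by
  rw [g1f_mul_g1f hq0 hq1 hx1 hx2 hy1 hy2 hxm hy, g2f_eq_tsum_stuffle, g2f_eq_tsum_stuffle]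
  simp only [mul_comm (g1Term q x2 y2 _)]

/-- The shuffle product of depth-one generating series. -/
lemma g1f_shuffle {q x1 x2 y1 y2 : ℝ} (hq0 : 0 < q) (hq1 : q < 1)
    (hx1 : Real.exp x1 * q < 1) (hx2 : Real.exp x2 * q < 1)
    (hy1 : Real.exp y1 * q < 1) (hy2 : Real.exp y2 * q < 1)
    (hym : y1 - y2 ≠ 0) (hx : Real.exp (x1 + x2) * q < 1) :
    g1f q x1 y1 * g1f q x2 y2 =
      g2f q (x1 + x2) x2 y1 (y2 - y1) + g2f q (x1 + x2) x1 y2 (y1 - y2)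
      + ((coth ((y1 - y2) / 2) / 2 - 1 / 2) * g1f q (x1 + x2) y1
        - (coth ((y1 - y2) / 2) / 2 + 1 / 2) * g1f q (x1 + x2) y2) := by
  rw [g1f_swap q x1 y1, g1f_swap q x2 y2, g1f_mul_g1f hq0 hq1 hy1 hy2 hx1 hx2 hym hx,
    g2f_eq_tsum_shuffle, add_comm x1 x2, g2f_eq_tsum_shuffle, g1f_swap q _ y1, g1f_swap q _ y2]
  simp only [mul_comm (g1Term q y2 x2 _)]
  ring

/-- the double shuffle equations for combinatorial double Eisenstein series. -/
theorem stmt_13 (q x1 x2 y1 y2 : ℝ) (hq0 : 0 < q) (hq1 : q < 1)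
    (hx1 : x1 ≠ 0) (hx2 : x2 ≠ 0) (hy1 : y1 ≠ 0) (hy2 : y2 ≠ 0)
    (hxm : x1 - x2 ≠ 0) (hxp : x1 + x2 ≠ 0) (hym : y1 - y2 ≠ 0) (hyp : y1 + y2 ≠ 0)
    (hconv : |x1| + |x2| + |y1| + |y2| < Real.log (1 / q)) :
    E1 q x1 y1 * E1 q x2 y2 =
        E2 q x1 x2 y1 y2 + E2 q x2 x1 y2 y1 +
          (E1 q x1 (y1 + y2) - E1 q x2 (y1 + y2)) / (x1 - x2) ∧
      E1 q x1 y1 * E1 q x2 y2 =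
        E2 q (x1 + x2) x2 y1 (y2 - y1) + E2 q (x1 + x2) x1 y2 (y1 - y2) +
          (E1 q (x1 + x2) y1 - E1 q (x1 + x2) y2) / (y1 - y2) := by
  have hlt : ∀ t, t ≤ |x1| + |x2| + |y1| + |y2| → Real.exp t * q < 1 := by
    intro t ht
    have h := Real.exp_lt_exp.2 (ht.trans_lt hconv)
    rwa [Real.exp_log (by positivity), lt_div_iff₀ hq0] at h
  have ax1 := abs_nonneg x1
  have ax2 := abs_nonneg x2
  have ay1 := abs_nonneg y1
  have ay2 := abs_nonneg y2
  have lx1 := le_abs_self x1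
  have lx2 := le_abs_self x2
  have ly1 := le_abs_self y1
  have ly2 := le_abs_self y2
  have ex1 := hlt x1 (by linarith)
  have ex2 := hlt x2 (by linarith)
  have ey1 := hlt y1 (by linarith)
  have ey2 := hlt y2 (by linarith)
  constructor
  · have hb := Pb_eq_stuffle hx1 hx2 hy1 hy2 hxm hyp
    have hg := g1f_stuffle hq0 hq1 ex1 ex2 ey1 ey2 hxm (hlt (y1 + y2) (by linarith))
    have hc : ∀ y, b1 (x2 - x1) y = b1 (x1 - x2) y + coth ((x1 - x2) / 2) / 2 - (x1 - x2)⁻¹ := by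
      intro y
      rw [b1_eq_cothPart, b1_eq_cothPart, ← neg_sub x1 x2, cothPart_neg]
      simp only [cothPart]
      ring
    simp only [E1, E2]
    rw [add_comm y2 y1, hc, hc]
    linear_combination hb + hg
  · have hb := Pb_eq_shuffle hx1 hx2 hy1 hy2 hxp hym
    have hg := g1f_shuffle hq0 hq1 ex1 ex2 ey1 ey2 hym (hlt (x1 + x2) (by linarith))
    have hc : ∀ x, b1 x (y2 - y1) = b1 x (y1 - y2) + coth ((y1 - y2) / 2) / 2 - (y1 - y2)⁻¹ := by
      intro x
      rw [b1_eq_cothPart, b1_eq_cothPart, ← neg_sub y1 y2, cothPart_neg]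
      simp only [cothPart]
      ring
    simp only [E1, E2, add_sub_cancel_right, add_sub_cancel_left, add_sub_cancel, hc]
    linear_combination hb + hg
end
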